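/- Let n ≥ 2, let Λ be a finite index set, S ⊆ Λ, ε ∈ (0,1], and let y : Λ → [0,1]. Let p, p' : Λ → [0,1] and q_2, …, q_n : Λ → [0,1] be sequences with p'(t) = q_s(t) = p(t) for all t ∈ Λ∖S and all s ∈ {2,…,n}. Suppose: (a) for each s ∈ {2,…,n}, q_s is perfectly calibrated conditionally on p over S, i.e., for all v, v' ∈ [0,1]: ∑_{t ∈ S : q_s(t) = v and p(t) = v'} (v − y_t) = 0; (b) p' is perfectly calibrated conditionally on each q_s over S, i.e., for all s ∈ {2,…,n} and all v, v' ∈ [0,1]: ∑_{t ∈ S : p'(t) = v and q_s(t) = v'} (v − y_t) = 0; and (c) D ⊆ S is a set such that every t ∈ D has some s ∈ {2,…,n} with |p'(t) − q_s(t)| ≥ ε/2. Then ∑_{t∈Λ} (p'(t) − y_t)² ≤ ∑_{t∈Λ} (p(t) − y_t)² − (ε²/4)·|D|/(n−1). -/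

import Mathlib

open Finset
open scoped Classical

/-- If `f` is calibrated conditionally on `g` over `S`, then the residual `f - y` is orthogonal over
`S` to every function of the pair `(f, g)`. -/
lemma sum_mul_sub_eq_zero_of_calibrated {Λ : Type*} (S : Finset Λ) (I : Set ℝ) (f g y : Λ → ℝ)
    (hf : ∀ t, f t ∈ I) (hg : ∀ t, g t ∈ I)
    (hcal : ∀ v ∈ I, ∀ v' ∈ I, ∑ t ∈ S, (if f t = v ∧ g t = v' then v - y t else 0) = 0)
    (F : ℝ → ℝ → ℝ) :
    ∑ t ∈ S, F (f t) (g t) * (f t - y t) = 0 := by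
  rw [← Finset.sum_fiberwise_of_maps_to (t := S.image fun t => (f t, g t))
    (g := fun t => (f t, g t)) (fun t ht => Finset.mem_image_of_mem _ ht)]
  refine Finset.sum_eq_zero fun w hw => ?_
  obtain ⟨u, -, rfl⟩ := Finset.mem_image.mp hw
  have h := congrArg (F (f u) (g u) * ·) (hcal (f u) (hf u) (g u) (hg u))
  simp only [mul_zero, Finset.mul_sum] at h
  rw [Finset.sum_filter]
  refine (Finset.sum_congr rfl fun t _ => ?_).trans h
  by_cases ht : f t = f u ∧ g t = g u
  · simp [ht.1, ht.2]
  · simp [ht]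

/-- Pythagorean identity for squared error under conditional calibration. -/
lemma sum_sq_sub_eq_of_calibrated {Λ : Type*} (S : Finset Λ) (I : Set ℝ) (f g y : Λ → ℝ)
    (hf : ∀ t, f t ∈ I) (hg : ∀ t, g t ∈ I)
    (hcal : ∀ v ∈ I, ∀ v' ∈ I, ∑ t ∈ S, (if f t = v ∧ g t = v' then v - y t else 0) = 0) :
    ∑ t ∈ S, (g t - y t) ^ 2 = ∑ t ∈ S, (f t - y t) ^ 2 + ∑ t ∈ S, (f t - g t) ^ 2 := by
  have h := sum_mul_sub_eq_zero_of_calibrated S I f g y hf hg hcal fun a b => 2 * (b - a)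
  rw [← add_zero (∑ t ∈ S, (f t - y t) ^ 2 + _), ← h, ← Finset.sum_add_distrib,
    ← Finset.sum_add_distrib]
  exact Finset.sum_congr rfl fun t _ => by ring

/-- **Per-cycle potential lemma for the `n`-agent agreement protocol**
(underlying `thm:nparties`, with perfect conversation calibration).  `p` is
agent 1's prediction at the start of a cycle, `q_s` (for `s ∈ {2,…,n}`) the
predictions of agents `2,…,n` during the cycle, each perfectly calibrated
conditionally on `p` over the active days `S`; `p'` is agent 1's prediction at
the end of the cycle, perfectly calibrated conditionally on each `q_s` over
`S`; off `S` all sequences agree with `p`.  If every day in `D ⊆ S` has some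
agent `(ε/2)`-disagreeing with agent 1, then
`SQE(p') ≤ SQE(p) − (ε²/4)·|D|/(n−1)`. -/
theorem n_agent_cycle_potential
    {Λ : Type} [Fintype Λ] [DecidableEq Λ]
    (n : ℕ) (hn : 2 ≤ n)
    (S : Finset Λ)
    (ε : ℝ) (hε0 : 0 < ε) (hε1 : ε ≤ 1)
    (y : Λ → ℝ) (hy : ∀ t, y t ∈ Set.Icc (0 : ℝ) 1)
    (p p' : Λ → ℝ) (q : ℕ → Λ → ℝ)
    (hp : ∀ t, p t ∈ Set.Icc (0 : ℝ) 1)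
    (hp' : ∀ t, p' t ∈ Set.Icc (0 : ℝ) 1)
    (hq : ∀ s ∈ Finset.Icc 2 n, ∀ t, q s t ∈ Set.Icc (0 : ℝ) 1)
    (hoff : ∀ t ∉ S, p' t = p t ∧ ∀ s ∈ Finset.Icc 2 n, q s t = p t)
    -- (a) each q_s is perfectly calibrated conditionally on p over S
    (hcalq : ∀ s ∈ Finset.Icc 2 n, ∀ v ∈ Set.Icc (0 : ℝ) 1, ∀ v' ∈ Set.Icc (0 : ℝ) 1,
      ∑ t ∈ S, (if q s t = v ∧ p t = v' then v - y t else 0) = 0)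
    -- (b) p' is perfectly calibrated conditionally on each q_s over S
    (hcalp' : ∀ s ∈ Finset.Icc 2 n, ∀ v ∈ Set.Icc (0 : ℝ) 1, ∀ v' ∈ Set.Icc (0 : ℝ) 1,
      ∑ t ∈ S, (if p' t = v ∧ q s t = v' then v - y t else 0) = 0)
    -- (c) on every day of D, some agent (ε/2)-disagrees with agent 1
    (D : Finset Λ) (hDS : D ⊆ S)
    (hD : ∀ t ∈ D, ∃ s ∈ Finset.Icc 2 n, ε / 2 ≤ |p' t - q s t|) :
    ∑ t : Λ, (p' t - y t) ^ 2 ≤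
      ∑ t : Λ, (p t - y t) ^ 2 - (ε ^ 2 / 4) * (D.card : ℝ) / ((n : ℝ) - 1) := by
  have hn1 : (0 : ℝ) < (n : ℝ) - 1 := by
    have : (2 : ℝ) ≤ n := by exact_mod_cast hn
    linarith
  have hagent : ∀ s ∈ Finset.Icc 2 n, ∑ t ∈ S, (p' t - q s t) ^ 2 ≤
      ∑ t ∈ S, (p t - y t) ^ 2 - ∑ t ∈ S, (p' t - y t) ^ 2 := by
    intro s hs
    have hpq := sum_sq_sub_eq_of_calibrated S _ (q s) p y (hq s hs) hp (hcalq s hs)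
    have hqp' := sum_sq_sub_eq_of_calibrated S _ p' (q s) y hp' (hq s hs) (hcalp' s hs)
    have hnonneg : 0 ≤ ∑ t ∈ S, (q s t - p t) ^ 2 := Finset.sum_nonneg fun t _ => sq_nonneg _
    linarith
  have hupper := Finset.sum_le_sum hagent
  rw [Finset.sum_const, Nat.card_Icc, nsmul_eq_mul, Finset.sum_comm] at hupper
  have hcard : ((n + 1 - 2 : ℕ) : ℝ) = (n : ℝ) - 1 := by
    rw [Nat.cast_sub (by omega)]
    push_cast
    ring
  have hlower : (D.card : ℝ) * (ε ^ 2 / 4) ≤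
      ∑ t ∈ S, ∑ s ∈ Finset.Icc 2 n, (p' t - q s t) ^ 2 := by
    calc (D.card : ℝ) * (ε ^ 2 / 4) = ∑ t ∈ D, ε ^ 2 / 4 := by
          rw [Finset.sum_const, nsmul_eq_mul]
      _ ≤ ∑ t ∈ D, ∑ s ∈ Finset.Icc 2 n, (p' t - q s t) ^ 2 := by
          refine Finset.sum_le_sum fun t ht => ?_
          obtain ⟨s, hs, hdis⟩ := hD t ht
          calc ε ^ 2 / 4 = (ε / 2) ^ 2 := by ring
            _ ≤ |p' t - q s t| ^ 2 := by gcongr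
            _ = (p' t - q s t) ^ 2 := sq_abs _
            _ ≤ _ := Finset.single_le_sum (f := fun s => (p' t - q s t) ^ 2)
                (fun i _ => sq_nonneg _) hs
      _ ≤ _ := Finset.sum_le_sum_of_subset_of_nonneg hDS fun t _ _ =>
          Finset.sum_nonneg fun s _ => sq_nonneg _
  have hdrop : ε ^ 2 / 4 * (D.card : ℝ) / ((n : ℝ) - 1) ≤
      ∑ t ∈ S, (p t - y t) ^ 2 - ∑ t ∈ S, (p' t - y t) ^ 2 := by
    rw [div_le_iff₀ hn1]
    rw [hcard] at hupper
    linarith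
  have hcompl : ∑ t ∈ Sᶜ, (p' t - y t) ^ 2 = ∑ t ∈ Sᶜ, (p t - y t) ^ 2 :=
    Finset.sum_congr rfl fun t ht => by rw [(hoff t (Finset.mem_compl.mp ht)).1]
  rw [← Finset.sum_add_sum_compl S, ← Finset.sum_add_sum_compl S fun t => (p t - y t) ^ 2]
  linarith
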